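/- Let W be a symmetric discrete memoryless channel with R_cr < C(W) and fix a rate R with R_∞ < R < C(W). Define e_SP(r,R) = inf{ D(V∥W|U_X) : V a channel from X to Y with D(V∥q_R|U_X) ≤ r } for R_∞ < r ≤ R. Then e_SP(R,R) = E_SP(R). -/

import Mathlib

open Real Finset

variable {X Y : Type} [Fintype X] [Fintype Y]

/-- A discrete memoryless channel: `W x y` is the probability of output `y` given input `x`. -/
def IsDMC (W : X → Y → ℝ) : Prop :=
  (∀ x y, 0 ≤ W x y) ∧ ∀ x, ∑ y, W x y = 1

/-- A probability distribution on a finite alphabet. -/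
def IsProbDist (Q : X → ℝ) : Prop :=
  (∀ x, 0 ≤ Q x) ∧ ∑ x, Q x = 1

/-- Gallager symmetry: the output alphabet can be partitioned into classes such that within
each class every row is a permutation of every other row, and every column is a permutation
of every other column. -/
def GallagerSymmetric (W : X → Y → ℝ) : Prop :=
  ∃ cls : Y → ℕ,
    (∀ (l : ℕ) (x x' : X),
        ((Finset.univ.filter fun y => cls y = l).val.map fun y => W x y) =
        ((Finset.univ.filter fun y => cls y = l).val.map fun y => W x' y)) ∧
    (∀ y y' : Y, cls y = cls y' →
        (Finset.univ.val.map fun x => W x y) = (Finset.univ.val.map fun x => W x y'))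

/-- Singularity: whenever two inputs both give an output positive probability,
they give it the same probability. -/
def Singular (W : X → Y → ℝ) : Prop :=
  ∀ x z y, 0 < W x y * W z y → W x y = W z y

/-- Gallager's function `E_o(ρ, Q)`. -/
noncomputable def Eo (W : X → Y → ℝ) (Q : X → ℝ) (ρ : ℝ) : ℝ :=
  - Real.log (∑ y, (∑ x, Q x * W x y ^ (1 / (1 + ρ))) ^ (1 + ρ))

/-- Mutual information `I(Q; W)`. -/
noncomputable def mutualInfo (W : X → Y → ℝ) (Q : X → ℝ) : ℝ :=
  ∑ x, ∑ y, Q x * W x y * Real.log (W x y / ∑ z, Q z * W z y)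

/-- Channel capacity `C(W)`. -/
noncomputable def capacity (W : X → Y → ℝ) : ℝ :=
  sSup {r | ∃ Q, IsProbDist Q ∧ r = mutualInfo W Q}

/-- The set of values whose supremum is the sphere-packing exponent. -/
def ESPset (W : X → Y → ℝ) (R : ℝ) : Set ℝ :=
  {e | ∃ Q, IsProbDist Q ∧ ∃ ρ : ℝ, 0 ≤ ρ ∧ e = Eo W Q ρ - ρ * R}

/-- The sphere-packing exponent `E_SP(R) = max_Q sup_{ρ ≥ 0} (E_o(ρ,Q) - ρ R)`. -/
noncomputable def ESP (W : X → Y → ℝ) (R : ℝ) : ℝ := sSup (ESPset W R)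

/-- The random coding exponent `E_r(R) = max_Q max_{0 ≤ ρ ≤ 1} (E_o(ρ,Q) - ρ R)`. -/
noncomputable def Er (W : X → Y → ℝ) (R : ℝ) : ℝ :=
  sSup {e | ∃ Q, IsProbDist Q ∧ ∃ ρ : ℝ, 0 ≤ ρ ∧ ρ ≤ 1 ∧ e = Eo W Q ρ - ρ * R}

/-- `R_∞`: the supremum of rates at which the sphere-packing exponent is infinite
(i.e. the defining supremum is unbounded). -/
noncomputable def Rinf (W : X → Y → ℝ) : ℝ :=
  sSup {R | ¬ BddAbove (ESPset W R)}

/-- The critical rate `R_cr`: the smallest rate above which `E_r = E_SP`. -/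
noncomputable def Rcr (W : X → Y → ℝ) : ℝ :=
  sInf {R | ∀ R', R ≤ R' → Er W R' = ESP W R'}

/-- Number of messages of an `(N, R)` code: `⌈e^{NR}⌉`. -/
noncomputable def Mof (N : ℕ) (R : ℝ) : ℕ := ⌈Real.exp (N * R)⌉₊

/-- Error probability of message `m` for a (non-feedback) block code. -/
noncomputable def msgErrorProb (W : X → Y → ℝ) {N M : ℕ}
    (f : Fin M → Fin N → X) (φ : (Fin N → Y) → Fin M) (m : Fin M) : ℝ :=
  ∑ y ∈ Finset.univ.filter (fun y : Fin N → Y => φ y ≠ m), ∏ n, W (f m n) (y n)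

/-- Average error probability of a (non-feedback) block code. -/
noncomputable def avgErrorProb (W : X → Y → ℝ) {N M : ℕ}
    (f : Fin M → Fin N → X) (φ : (Fin N → Y) → Fin M) : ℝ :=
  (M : ℝ)⁻¹ * ∑ m, msgErrorProb W f φ m

/-- A feedback encoder, given as a function of the whole output word, is causal if the symbol
sent at time `n` depends only on the message and the outputs at times `< n`. -/
def Causal {N M : ℕ} (f : Fin M → (Fin N → Y) → Fin N → X) : Prop :=
  ∀ m y y' n, (∀ k, k < n → y k = y' k) → f m y n = f m y' n

/-- Average error probability of a feedback code. -/
noncomputable def avgErrorProbFb (W : X → Y → ℝ) {N M : ℕ}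
    (f : Fin M → (Fin N → Y) → Fin N → X) (φ : (Fin N → Y) → Fin M) : ℝ :=
  (M : ℝ)⁻¹ * ∑ m, ∑ y ∈ Finset.univ.filter (fun y : Fin N → Y => φ y ≠ m),
      ∏ n, W (f m y n) (y n)


open scoped ENNReal
/-- Conditional Kullback–Leibler divergence `D(V ∥ W | Q)`, valued in `ℝ≥0∞`
(it is infinite when `V` is not absolutely continuous w.r.t. `W` on the support of `Q`). -/
noncomputable def condKL (Q : X → ℝ) (V W : X → Y → ℝ) : ℝ≥0∞ :=
  if ∀ x y, 0 < Q x → 0 < V x y → 0 < W x y then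
    ENNReal.ofReal (∑ x, ∑ y, Q x * (V x y * Real.log (V x y / W x y)))
  else ⊤

/-- The sphere-packing exponent at input distribution `Q`:
`E_SP(R, Q) = inf { D(V∥W|Q) : V a channel with I(Q;V) ≤ R }`. -/
noncomputable def ESPQ (W : X → Y → ℝ) (R : ℝ) (Q : X → ℝ) : ℝ≥0∞ :=
  ⨅ V ∈ {V : X → Y → ℝ | IsDMC V ∧ mutualInfo V Q ≤ R}, condKL Q V W

/-- The sphere-packing exponent `E_SP(R) = max_Q E_SP(R, Q)`. -/
noncomputable def ESPKL (W : X → Y → ℝ) (R : ℝ) : ℝ≥0∞ :=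
  ⨆ Q ∈ {Q : X → ℝ | IsProbDist Q}, ESPQ W R Q

/-- `Ẽ_SP(R, Q) = sup_{ρ ≥ 0} (E_o(ρ, Q) - ρ R)`. -/
noncomputable def tESPQ (W : X → Y → ℝ) (R : ℝ) (Q : X → ℝ) : ℝ :=
  sSup {e | ∃ ρ : ℝ, 0 ≤ ρ ∧ e = Eo W Q ρ - ρ * R}

/-- `Ẽ_SP(R) = max_Q Ẽ_SP(R, Q)`. -/
noncomputable def tESP (W : X → Y → ℝ) (R : ℝ) : ℝ :=
  sSup {e | ∃ Q, IsProbDist Q ∧ e = tESPQ W R Q}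

/-- `R_∞`: the supremum of rates at which `E_SP(R) = ∞`. -/
noncomputable def RinfKL (W : X → Y → ℝ) : ℝ :=
  sSup {R | ESPKL W R = ⊤}

/-- The critical rate `R_cr`: the smallest rate above which `E_r = E_SP`. -/
noncomputable def RcrKL (W : X → Y → ℝ) : ℝ :=
  sInf {R | ∀ R', R ≤ R' → ENNReal.ofReal (Er W R') = ESPKL W R'}

/-- The uniform distribution on the input alphabet. -/
noncomputable def unif (X : Type) [Fintype X] : X → ℝ := fun _ => (Fintype.card X : ℝ)⁻¹

variable {X Y : Type} [Fintype X] [Fintype Y]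

/-- The tilted output distribution `q_R` (defined from the multiplier `ρR`). -/
noncomputable def qR (W : X → Y → ℝ) (ρR : ℝ) : Y → ℝ := fun y =>
  (∑ x, (Fintype.card X : ℝ)⁻¹ * W x y ^ (1 / (1 + ρR))) ^ (1 + ρR) /
    ∑ b, (∑ a, (Fintype.card X : ℝ)⁻¹ * W a b ^ (1 / (1 + ρR))) ^ (1 + ρR)

/-- Conditional KL divergence `D(V ∥ q | Q)` of a channel `V` against an output
distribution `q`, valued in `ℝ≥0∞`. -/
noncomputable def condKLout (Q : X → ℝ) (V : X → Y → ℝ) (q : Y → ℝ) : ℝ≥0∞ :=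
  if ∀ x y, 0 < Q x → 0 < V x y → 0 < q y then
    ENNReal.ofReal (∑ x, ∑ y, Q x * (V x y * Real.log (V x y / q y)))
  else ⊤

/-- `e_SP(r, R) = inf { D(V∥W|U_X) : D(V∥q_R|U_X) ≤ r }`. -/
noncomputable def eSP (W : X → Y → ℝ) (q : Y → ℝ) (r : ℝ) : ℝ≥0∞ :=
  ⨅ V ∈ {V : X → Y → ℝ | IsDMC V ∧ condKLout (unif X) V q ≤ ENNReal.ofReal r},
    condKL (unif X) V W

open Set Filter Topology

lemma sub_le_mul_log_div {a b : ℝ} (ha : 0 ≤ a) (hb : 0 ≤ b) (hab : 0 < a → 0 < b) :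
    a - b ≤ a * Real.log (a / b) := by
  rcases ha.eq_or_lt with rfl | ha
  · simpa using hb
  · have hb := hab ha
    have h := Real.one_sub_inv_le_log_of_pos (div_pos ha hb)
    calc a - b = a * (1 - (a / b)⁻¹) := by field_simp
      _ ≤ _ := by gcongr

lemma exists_pos_of_sum_pos {ι : Type*} [Fintype ι] {f : ι → ℝ} (h : 0 < ∑ i, f i) :
    ∃ i, 0 < f i := by
  by_contra! hf
  exact h.not_ge (Finset.sum_nonpos fun i _ => hf i)

lemma rpow_one_add_tangent_le {a b ρ : ℝ} (ha : 0 ≤ a) (hb : 0 ≤ b) (hρ : 0 ≤ ρ) :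
    a ^ (1 + ρ) + (1 + ρ) * (a ^ ρ * (b - a)) ≤ b ^ (1 + ρ) := by
  rcases ha.eq_or_lt with rfl | ha
  · rcases hρ.eq_or_lt with rfl | hρ
    · simp
    · rw [Real.zero_rpow (by positivity), Real.zero_rpow hρ.ne']
      simpa using Real.rpow_nonneg hb _
  · have h := one_add_mul_self_le_rpow_one_add (s := b / a - 1) (p := 1 + ρ)
      (by linarith [div_nonneg hb ha.le]) (by linarith)
    rw [add_sub_cancel, Real.div_rpow hb ha.le, le_div_iff₀ (by positivity)] at h
    have e : a ^ (1 + ρ) = a * a ^ ρ := by rw [Real.rpow_add ha, Real.rpow_one]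
    calc _ = (1 + (1 + ρ) * (b / a - 1)) * a ^ (1 + ρ) := by
          rw [e]; field_simp
      _ ≤ _ := h

/-- A continuous function on `[0, ∞)` that lies above the level `r` to the left of a point and
below it to the right takes the value `r` there, up to the boundary case. -/
lemma ContinuousOn.level_of_crossing {φ : ℝ → ℝ} (hφ : ContinuousOn φ (Ici 0)) {t r : ℝ}
    (ht : 0 ≤ t) (h : ∀ u, 0 ≤ u → (u - t) * (φ u - r) ≤ 0) :
    φ t ≤ r ∧ (0 < t → r ≤ φ t) := by
  have hc := hφ t ht
  constructor
  · have h1 : Tendsto φ (𝓝[>] t) (𝓝 (φ t)) :=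
      hc.mono fun u hu => ht.trans (le_of_lt hu)
    refine le_of_tendsto h1 ?_
    filter_upwards [self_mem_nhdsWithin] with u hu
    have hu' : 0 < u - t := sub_pos.2 hu
    have := h u (ht.trans (le_of_lt hu))
    nlinarith
  · intro ht0
    have h1 : Tendsto φ (𝓝[<] t) (𝓝 (φ t)) := by
      rw [← nhdsWithin_Ioo_eq_nhdsLT ht0]
      exact hc.mono fun u hu => le_of_lt hu.1
    refine ge_of_tendsto h1 ?_
    rw [← nhdsWithin_Ioo_eq_nhdsLT ht0]
    filter_upwards [self_mem_nhdsWithin] with u hu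
    have hu' : 0 < t - u := sub_pos.2 hu.2
    have := h u hu.1.le
    nlinarith

section Divergence

variable {X Y : Type} [Fintype X] [Fintype Y]

/-- The output distribution induced by the input distribution `Q`. -/
noncomputable def outDist (Q : X → ℝ) (V : X → Y → ℝ) (y : Y) : ℝ := ∑ x, Q x * V x y

lemma outDist_nonneg {Q : X → ℝ} {V : X → Y → ℝ} (hQ : ∀ x, 0 ≤ Q x) (hV : IsDMC V) (y : Y) :
    0 ≤ outDist Q V y :=
  Finset.sum_nonneg fun x _ => mul_nonneg (hQ x) (hV.1 x y)

lemma outDist_pos {Q : X → ℝ} {V : X → Y → ℝ} (hQ : ∀ x, 0 ≤ Q x) (hV : IsDMC V) {x : X} {y : Y}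
    (h : 0 < Q x * V x y) : 0 < outDist Q V y :=
  h.trans_le (Finset.single_le_sum (f := fun x => Q x * V x y)
    (fun x _ => mul_nonneg (hQ x) (hV.1 x y)) (Finset.mem_univ x))

lemma sum_outDist {Q : X → ℝ} {V : X → Y → ℝ} (hQ : IsProbDist Q) (hV : IsDMC V) :
    ∑ y, outDist Q V y = 1 := by
  unfold outDist
  rw [Finset.sum_comm]
  simp_rw [← Finset.mul_sum, hV.2, mul_one, hQ.2]

lemma mutualInfo_le_divergence {Q : X → ℝ} {V : X → Y → ℝ} (hQ : IsProbDist Q) (hV : IsDMC V)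
    {q : Y → ℝ} (hq : ∀ y, 0 ≤ q y) (hq1 : ∑ y, q y = 1)
    (hac : ∀ x y, 0 < Q x → 0 < V x y → 0 < q y) :
    mutualInfo V Q ≤ ∑ x, ∑ y, Q x * (V x y * Real.log (V x y / q y)) := by
  have hpq : ∀ y, 0 < outDist Q V y → 0 < q y := by
    intro y hy
    obtain ⟨x, hx⟩ := exists_pos_of_sum_pos hy
    exact hac x y (pos_of_mul_pos_left hx (hV.1 x y)) (pos_of_mul_pos_right hx (hQ.1 x))
  have key : ∀ x y, Q x * V x y * Real.log (V x y / outDist Q V y)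
      = Q x * (V x y * Real.log (V x y / q y))
        - Q x * V x y * Real.log (outDist Q V y / q y) := by
    intro x y
    rcases (mul_nonneg (hQ.1 x) (hV.1 x y)).eq_or_lt with h | h
    · rw [← mul_assoc, ← h]; simp
    · have hp := outDist_pos hQ.1 hV h
      have hq' := hpq y hp
      have hv : 0 < V x y := pos_of_mul_pos_right h (hQ.1 x)
      rw [Real.log_div hv.ne' hp.ne', Real.log_div hv.ne' hq'.ne', Real.log_div hp.ne' hq'.ne']
      ring
  have hsum : mutualInfo V Q = ∑ x, ∑ y, Q x * (V x y * Real.log (V x y / q y))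
      - ∑ y, outDist Q V y * Real.log (outDist Q V y / q y) := by
    have : ∑ y, outDist Q V y * Real.log (outDist Q V y / q y)
        = ∑ x, ∑ y, Q x * V x y * Real.log (outDist Q V y / q y) := by
      rw [Finset.sum_comm]
      refine Finset.sum_congr rfl fun y _ => ?_
      rw [← Finset.sum_mul]; rfl
    rw [this, ← Finset.sum_sub_distrib]
    refine Finset.sum_congr rfl fun x _ => ?_
    rw [← Finset.sum_sub_distrib]
    exact Finset.sum_congr rfl fun y _ => key x y
  have hpos : (0 : ℝ) ≤ ∑ y, outDist Q V y * Real.log (outDist Q V y / q y) := by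
    calc (0 : ℝ) = ∑ y, (outDist Q V y - q y) := by
          rw [Finset.sum_sub_distrib, sum_outDist hQ hV, hq1, sub_self]
      _ ≤ _ := Finset.sum_le_sum fun y _ =>
          sub_le_mul_log_div (outDist_nonneg hQ.1 hV y) (hq y) (hpq y)
  linarith

lemma mutualInfo_nonneg {Q : X → ℝ} {V : X → Y → ℝ} (hQ : IsProbDist Q) (hV : IsDMC V) :
    0 ≤ mutualInfo V Q := by
  calc (0 : ℝ) = ∑ x, ∑ y, (Q x * V x y - Q x * outDist Q V y) := by
        simp_rw [Finset.sum_sub_distrib, ← Finset.mul_sum, hV.2, sum_outDist hQ hV]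
        simp
    _ ≤ _ := by
      refine Finset.sum_le_sum fun x _ => Finset.sum_le_sum fun y _ => ?_
      rcases (mul_nonneg (hQ.1 x) (hV.1 x y)).eq_or_lt with h | h
      · rw [← h]
        simpa using mul_nonneg (hQ.1 x) (outDist_nonneg hQ.1 hV y)
      · have := sub_le_mul_log_div (hV.1 x y) (outDist_nonneg hQ.1 hV y)
          (fun _ => outDist_pos hQ.1 hV h)
        rw [← mul_sub, mul_assoc]
        exact mul_le_mul_of_nonneg_left this (hQ.1 x)

lemma GallagerSymmetric.sum_eq {A B : Type*} [Fintype B] {W : A → B → ℝ} {cls : B → ℕ}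
    (h : ∀ (l : ℕ) (x x' : A),
        ((Finset.univ.filter fun y => cls y = l).val.map fun y => W x y) =
        ((Finset.univ.filter fun y => cls y = l).val.map fun y => W x' y))
    (f : ℝ → ℝ → ℝ) {g : B → ℝ} (hg : ∀ y y', cls y = cls y' → g y = g y') (x x' : A) :
    ∑ y, f (W x y) (g y) = ∑ y, f (W x' y) (g y) := by
  classical
  have hmaps : ∀ y ∈ (Finset.univ : Finset B), cls y ∈ Finset.univ.image cls :=
    fun y hy => Finset.mem_image_of_mem _ hy
  rw [← Finset.sum_fiberwise_of_maps_to hmaps, ← Finset.sum_fiberwise_of_maps_to hmaps]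
  refine Finset.sum_congr rfl fun l hl => ?_
  obtain ⟨y₀, -, rfl⟩ := Finset.mem_image.1 hl
  have hfib : ∀ z, ∑ y with cls y = cls y₀, f (W z y) (g y)
      = ((((Finset.univ.filter fun y => cls y = cls y₀).val.map fun y => W z y)).map
          fun w => f w (g y₀)).sum := by
    intro z
    rw [Multiset.map_map]
    exact Finset.sum_congr rfl fun y hy => by
      simp [hg y y₀ (Finset.mem_filter.1 hy).2]
  rw [hfib, hfib, h]

lemma sum_col_eq {A B : Type*} [Fintype A] {W : A → B → ℝ} {y y' : B}
    (h : (Finset.univ.val.map fun x => W x y) = (Finset.univ.val.map fun x => W x y'))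
    (f : ℝ → ℝ) : ∑ x, f (W x y) = ∑ x, f (W x y') := by
  have := congrArg (fun m => (m.map f).sum) h
  simp only [Multiset.map_map] at this
  exact this

end Divergence

section Tilting

variable {X Y : Type} [Fintype X] [Fintype Y]

lemma unif_pos [Nonempty X] (x : X) : 0 < unif X x :=
  inv_pos.2 (Nat.cast_pos.2 Fintype.card_pos)

lemma isProbDist_unif [Nonempty X] : IsProbDist (unif X) :=
  ⟨fun x => (unif_pos x).le, by simp [unif]⟩

/-- The uniform average of `W(y|·)^{1/(1+ρ)}`. -/
noncomputable def powerMean (W : X → Y → ℝ) (ρ : ℝ) (y : Y) : ℝ :=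
  ∑ x, unif X x * W x y ^ (1 / (1 + ρ))

/-- The normalising constant `e^{-E_o(ρ, U)}`. -/
noncomputable def partitionFn (W : X → Y → ℝ) (ρ : ℝ) : ℝ :=
  ∑ y, powerMean W ρ y ^ (1 + ρ)

/-- The tilted channel, optimal in the sphere-packing problem. -/
noncomputable def tilt (W : X → Y → ℝ) (ρ : ℝ) (x : X) (y : Y) : ℝ :=
  W x y ^ (1 / (1 + ρ)) * powerMean W ρ y ^ ρ / partitionFn W ρ

lemma Eo_unif (W : X → Y → ℝ) (ρ : ℝ) : Eo W (unif X) ρ = -Real.log (partitionFn W ρ) := rfl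

lemma qR_eq (W : X → Y → ℝ) (ρ : ℝ) (y : Y) :
    qR W ρ y = powerMean W ρ y ^ (1 + ρ) / partitionFn W ρ := rfl

lemma tilt_eq_zero {W : X → Y → ℝ} {ρ : ℝ} (hρ : 0 ≤ ρ) {x : X} {y : Y} (h : W x y = 0) : tilt W ρ x y = 0 := by
  have : 1 / (1 + ρ) ≠ 0 := by positivity
  rw [tilt, h, Real.zero_rpow this, zero_mul, zero_div]

variable [Nonempty X] {W : X → Y → ℝ} {ρ : ℝ}

lemma powerMean_nonneg (hW : IsDMC W) (ρ : ℝ) (y : Y) : 0 ≤ powerMean W ρ y :=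
  Finset.sum_nonneg fun x _ => mul_nonneg (unif_pos x).le (Real.rpow_nonneg (hW.1 x y) _)

lemma powerMean_pos (hW : IsDMC W) (ρ : ℝ) {x : X} {y : Y} (h : 0 < W x y) :
    0 < powerMean W ρ y :=
  (mul_pos (unif_pos x) (Real.rpow_pos_of_pos h _)).trans_le
    (Finset.single_le_sum (f := fun x => unif X x * W x y ^ (1 / (1 + ρ)))
      (fun x _ => mul_nonneg (unif_pos x).le (Real.rpow_nonneg (hW.1 x y) _))
      (Finset.mem_univ x))

lemma partitionFn_pos (hW : IsDMC W) (ρ : ℝ) : 0 < partitionFn W ρ := by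
  have x := Classical.arbitrary X
  obtain ⟨y, hy⟩ := exists_pos_of_sum_pos (f := W x) (by rw [hW.2 x]; exact one_pos)
  exact (Real.rpow_pos_of_pos (powerMean_pos hW ρ hy) _).trans_le
    (Finset.single_le_sum (f := fun y => powerMean W ρ y ^ (1 + ρ))
      (fun y _ => Real.rpow_nonneg (powerMean_nonneg hW ρ y) _) (Finset.mem_univ y))

lemma qR_nonneg (hW : IsDMC W) (ρ : ℝ) (y : Y) : 0 ≤ qR W ρ y := by
  rw [qR_eq]
  exact div_nonneg (Real.rpow_nonneg (powerMean_nonneg hW ρ y) _) (partitionFn_pos hW ρ).le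

lemma sum_qR (hW : IsDMC W) (ρ : ℝ) : ∑ y, qR W ρ y = 1 := by
  simp_rw [qR_eq, ← Finset.sum_div]
  exact div_self (partitionFn_pos hW ρ).ne'

lemma qR_pos (hW : IsDMC W) (ρ : ℝ) {x : X} {y : Y} (h : 0 < W x y) : 0 < qR W ρ y := by
  rw [qR_eq]
  exact div_pos (Real.rpow_pos_of_pos (powerMean_pos hW ρ h) _) (partitionFn_pos hW ρ)

lemma rpow_one_add_eq_mul {b : ℝ} (hb : 0 ≤ b) (hρ : 0 ≤ ρ) : b ^ (1 + ρ) = b * b ^ ρ := by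
  rw [Real.rpow_add_of_nonneg hb zero_le_one hρ, Real.rpow_one]

lemma sum_unif_mul_rpow_mul (hW : IsDMC W) (hρ : 0 ≤ ρ) (y : Y) :
    ∑ x, unif X x * (W x y ^ (1 / (1 + ρ)) * powerMean W ρ y ^ ρ)
      = powerMean W ρ y ^ (1 + ρ) := by
  rw [rpow_one_add_eq_mul (powerMean_nonneg hW ρ y) hρ]
  simp_rw [← mul_assoc, ← Finset.sum_mul]
  rfl

/-- For symmetric channels the normalisation does not depend on the input letter. -/
lemma sum_rpow_mul_eq_partitionFn (hW : IsDMC W) (hsym : GallagerSymmetric W) (hρ : 0 ≤ ρ)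
    (x : X) : ∑ y, W x y ^ (1 / (1 + ρ)) * powerMean W ρ y ^ ρ = partitionFn W ρ := by
  obtain ⟨cls, hrow, hcol⟩ := hsym
  have hg : ∀ y y', cls y = cls y' → powerMean W ρ y = powerMean W ρ y' := fun y y' h =>
    sum_col_eq (hcol y y' h) fun w => (Fintype.card X : ℝ)⁻¹ * w ^ (1 / (1 + ρ))
  have hx : ∀ x', ∑ y, W x' y ^ (1 / (1 + ρ)) * powerMean W ρ y ^ ρ
      = ∑ y, W x y ^ (1 / (1 + ρ)) * powerMean W ρ y ^ ρ := fun x' =>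
    GallagerSymmetric.sum_eq hrow (fun w b => w ^ (1 / (1 + ρ)) * b ^ ρ) hg x' x
  calc _ = ∑ x', unif X x' * ∑ y, W x' y ^ (1 / (1 + ρ)) * powerMean W ρ y ^ ρ := by
        simp_rw [hx, ← Finset.sum_mul, isProbDist_unif.2, one_mul]
    _ = ∑ y, ∑ x', unif X x' * (W x' y ^ (1 / (1 + ρ)) * powerMean W ρ y ^ ρ) := by
        simp_rw [Finset.mul_sum]
        exact Finset.sum_comm
    _ = _ := Finset.sum_congr rfl fun y _ => sum_unif_mul_rpow_mul hW hρ y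

lemma isDMC_tilt (hW : IsDMC W) (hsym : GallagerSymmetric W) (hρ : 0 ≤ ρ) :
    IsDMC (tilt W ρ) := by
  refine ⟨fun x y => div_nonneg (mul_nonneg (Real.rpow_nonneg (hW.1 x y) _)
    (Real.rpow_nonneg (powerMean_nonneg hW ρ y) _)) (partitionFn_pos hW ρ).le, fun x => ?_⟩
  simp_rw [tilt, ← Finset.sum_div]
  rw [sum_rpow_mul_eq_partitionFn hW hsym hρ, div_self (partitionFn_pos hW ρ).ne']

lemma outDist_tilt (hW : IsDMC W) (hρ : 0 ≤ ρ) (y : Y) :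
    outDist (unif X) (tilt W ρ) y = qR W ρ y := by
  simp_rw [outDist, tilt, ← mul_div_assoc, ← Finset.sum_div]
  rw [sum_unif_mul_rpow_mul hW hρ, qR_eq]

lemma pos_of_tilt_pos (hW : IsDMC W) (hρ : 0 ≤ ρ) {x : X} {y : Y} (h : 0 < tilt W ρ x y) :
    0 < W x y :=
  (hW.1 x y).lt_of_ne fun h0 => h.ne' (tilt_eq_zero hρ h0.symm)

lemma tilt_pos (hW : IsDMC W) (ρ : ℝ) {x : X} {y : Y} (h : 0 < W x y) : 0 < tilt W ρ x y :=
  div_pos (mul_pos (Real.rpow_pos_of_pos h _)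
    (Real.rpow_pos_of_pos (powerMean_pos hW ρ h) _)) (partitionFn_pos hW ρ)

lemma mutualInfo_tilt (hW : IsDMC W) (hρ : 0 ≤ ρ) :
    mutualInfo (tilt W ρ) (unif X)
      = ∑ x, ∑ y, unif X x * (tilt W ρ x y * Real.log (tilt W ρ x y / qR W ρ y)) := by
  refine Finset.sum_congr rfl fun x _ => Finset.sum_congr rfl fun y _ => ?_
  rw [← outDist_tilt hW hρ, mul_assoc]; rfl

lemma tilt_zero (hW : IsDMC W) : tilt W 0 = W := by
  have hZ : partitionFn W 0 = 1 := by
    have := sum_outDist isProbDist_unif hW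
    simpa [partitionFn, powerMean, outDist] using this
  ext x y
  simp [tilt, hZ]

lemma Eo_unif_zero (hW : IsDMC W) : Eo W (unif X) 0 = 0 := by
  have := sum_outDist isProbDist_unif hW
  simp only [outDist] at this
  simp [Eo, this]

lemma divergence_tilt (hW : IsDMC W) (hsym : GallagerSymmetric W) (hρ : 0 ≤ ρ) :
    ∑ x, ∑ y, unif X x * (tilt W ρ x y * Real.log (tilt W ρ x y / W x y))
      = Eo W (unif X) ρ - ρ * mutualInfo (tilt W ρ) (unif X) := by
  have key : ∀ x y, unif X x * (tilt W ρ x y * Real.log (tilt W ρ x y / W x y))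
      = Eo W (unif X) ρ * (unif X x * tilt W ρ x y)
        - ρ * (unif X x * (tilt W ρ x y * Real.log (tilt W ρ x y / qR W ρ y))) := by
    intro x y
    rcases (hW.1 x y).eq_or_lt with h | h
    · simp [tilt_eq_zero hρ h.symm]
    · have hb := powerMean_pos hW ρ h
      have hZ := partitionFn_pos hW ρ
      have ht := tilt_pos hW ρ h
      have hq := qR_pos hW ρ h
      have e1 : Real.log (tilt W ρ x y) = 1 / (1 + ρ) * Real.log (W x y)
          + ρ * Real.log (powerMean W ρ y) - Real.log (partitionFn W ρ) := by
        rw [tilt, Real.log_div (by positivity) hZ.ne', Real.log_mul (by positivity)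
          (by positivity), Real.log_rpow h, Real.log_rpow hb]
      have e2 : Real.log (qR W ρ y) = (1 + ρ) * Real.log (powerMean W ρ y)
          - Real.log (partitionFn W ρ) := by
        rw [qR_eq, Real.log_div (by positivity) hZ.ne', Real.log_rpow hb]
      rw [Real.log_div ht.ne' h.ne', Real.log_div ht.ne' hq.ne', e1, e2, Eo_unif]
      field_simp
      ring
  have hone : ∑ x, ∑ y, unif X x * tilt W ρ x y = 1 := by
    simp_rw [← Finset.mul_sum, (isDMC_tilt hW hsym hρ).2, mul_one]
    exact isProbDist_unif.2
  simp_rw [key, Finset.sum_sub_distrib, ← Finset.mul_sum]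
  simp_rw [← Finset.mul_sum] at hone
  rw [hone, mutualInfo_tilt hW hρ, mul_one]
  simp_rw [← Finset.mul_sum]

/-- Weak duality between the two forms of the sphere-packing exponent. -/
lemma Eo_unif_le (hW : IsDMC W) (hρ : 0 ≤ ρ) {V : X → Y → ℝ} (hV : IsDMC V)
    (hac : ∀ x y, 0 < V x y → 0 < W x y) :
    Eo W (unif X) ρ ≤ ∑ x, ∑ y, unif X x * (V x y * Real.log (V x y / W x y))
      + ρ * mutualInfo V (unif X) := by
  set p := outDist (unif X) V with hp
  have hU := isProbDist_unif (X := X)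
  have hp0 : ∀ y, 0 ≤ p y := outDist_nonneg hU.1 hV
  have hb0 := powerMean_nonneg hW ρ
  have hZ := partitionFn_pos hW ρ
  have key : ∀ x y, (1 + ρ) * (unif X x * V x y
        - p y * (unif X x * W x y ^ (1 / (1 + ρ)) / powerMean W ρ y))
        + unif X x * V x y * Real.log (p y / qR W ρ y)
      ≤ unif X x * (V x y * Real.log (V x y / W x y))
        + ρ * (unif X x * V x y * Real.log (V x y / p y))
        + unif X x * V x y * Real.log (partitionFn W ρ) := by
    intro x y
    have hu := unif_pos x
    have hBn : 0 ≤ p y * (unif X x * W x y ^ (1 / (1 + ρ)) / powerMean W ρ y) :=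
      mul_nonneg (hp0 y) (div_nonneg (mul_nonneg hu.le (Real.rpow_nonneg (hW.1 x y) _)) (hb0 y))
    rcases (hV.1 x y).eq_or_lt with h | h
    · rw [← h]
      have : 0 ≤ (1 + ρ) * (p y * (unif X x * W x y ^ (1 / (1 + ρ)) / powerMean W ρ y)) := by
        positivity
      simp only [mul_zero, zero_mul, zero_sub, add_zero, mul_neg]
      linarith
    · have hw := hac x y h
      have hpy : 0 < p y := outDist_pos hU.1 hV (mul_pos hu h)
      have hb := powerMean_pos hW ρ hw
      have hq := qR_pos hW ρ hw
      have hB : 0 < p y * (unif X x * W x y ^ (1 / (1 + ρ)) / powerMean W ρ y) := by positivity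
      have g := sub_le_mul_log_div (mul_pos hu h).le hBn fun _ => hB
      have e1 : Real.log (unif X x * V x y /
          (p y * (unif X x * W x y ^ (1 / (1 + ρ)) / powerMean W ρ y)))
          = Real.log (V x y) - Real.log (p y) - 1 / (1 + ρ) * Real.log (W x y)
            + Real.log (powerMean W ρ y) := by
        rw [Real.log_div (by positivity) (by positivity), Real.log_mul hu.ne' h.ne',
          Real.log_mul hpy.ne' (by positivity), Real.log_div (by positivity) hb.ne',
          Real.log_mul hu.ne' (by positivity), Real.log_rpow hw]
        ring
      have e2 : Real.log (qR W ρ y) = (1 + ρ) * Real.log (powerMean W ρ y)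
          - Real.log (partitionFn W ρ) := by
        rw [qR_eq, Real.log_div (by positivity) hZ.ne', Real.log_rpow hb]
      rw [e1] at g
      have g' := mul_le_mul_of_nonneg_left g (by positivity : 0 ≤ 1 + ρ)
      rw [Real.log_div hpy.ne' hq.ne', Real.log_div h.ne' hw.ne', Real.log_div h.ne' hpy.ne', e2]
      have e3 : (1 + ρ) * (unif X x * V x y * (Real.log (V x y) - Real.log (p y)
          - 1 / (1 + ρ) * Real.log (W x y) + Real.log (powerMean W ρ y)))
          = unif X x * V x y * ((1 + ρ) * (Real.log (V x y) - Real.log (p y))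
            - Real.log (W x y) + (1 + ρ) * Real.log (powerMean W ρ y)) := by
        field_simp
      rw [e3] at g'
      linarith
  have hsum := Finset.sum_le_sum fun x (_ : x ∈ Finset.univ) =>
    Finset.sum_le_sum fun y (_ : y ∈ Finset.univ) => key x y
  have hone : ∑ x, ∑ y, unif X x * V x y = 1 := by
    simp_rw [← Finset.mul_sum, hV.2, mul_one]
    exact hU.2
  have hL1 : ∑ x, ∑ y, p y * (unif X x * W x y ^ (1 / (1 + ρ)) / powerMean W ρ y) ≤ 1 := by
    rw [Finset.sum_comm]
    calc _ = ∑ y, p y * (powerMean W ρ y / powerMean W ρ y) := by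
          refine Finset.sum_congr rfl fun y _ => ?_
          rw [← Finset.mul_sum, ← Finset.sum_div]; rfl
      _ ≤ ∑ y, p y * 1 := Finset.sum_le_sum fun y _ =>
          mul_le_mul_of_nonneg_left (div_self_le_one _) (hp0 y)
      _ = 1 := by simp_rw [mul_one]; exact sum_outDist hU hV
  have hL2 : 0 ≤ ∑ x, ∑ y, unif X x * V x y * Real.log (p y / qR W ρ y) := by
    rw [Finset.sum_comm]
    calc (0 : ℝ) = ∑ y, (p y - qR W ρ y) := by
          rw [Finset.sum_sub_distrib, sum_outDist hU hV, sum_qR hW, sub_self]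
      _ ≤ ∑ y, p y * Real.log (p y / qR W ρ y) := by
          refine Finset.sum_le_sum fun y _ =>
            sub_le_mul_log_div (hp0 y) (qR_nonneg hW ρ y) fun hy => ?_
          obtain ⟨x, hx⟩ := exists_pos_of_sum_pos hy
          exact qR_pos hW ρ (hac x y (pos_of_mul_pos_right hx (hU.1 x)))
      _ = _ := by
          refine Finset.sum_congr rfl fun y _ => ?_
          rw [← Finset.sum_mul]; rfl
  have hI : mutualInfo V (unif X)
      = ∑ x, ∑ y, unif X x * V x y * Real.log (V x y / p y) := rfl
  simp only [Finset.sum_add_distrib, Finset.sum_sub_distrib, ← Finset.mul_sum,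
    ← Finset.sum_mul] at hsum hone hL1 hL2 hI ⊢
  rw [hone, one_mul, ← hI] at hsum
  rw [Eo_unif]
  nlinarith

/-- For symmetric channels the uniform input distribution maximises `E_o(ρ, ·)`. -/
lemma Eo_le_Eo_unif (hW : IsDMC W) (hsym : GallagerSymmetric W) (hρ : 0 ≤ ρ) {Q : X → ℝ}
    (hQ : IsProbDist Q) : Eo W Q ρ ≤ Eo W (unif X) ρ := by
  have h : ∀ y, powerMean W ρ y ^ (1 + ρ) + (1 + ρ) *
      (powerMean W ρ y ^ ρ * (∑ x, Q x * W x y ^ (1 / (1 + ρ)) - powerMean W ρ y))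
      ≤ (∑ x, Q x * W x y ^ (1 / (1 + ρ))) ^ (1 + ρ) := fun y =>
    rpow_one_add_tangent_le (powerMean_nonneg hW ρ y)
      (Finset.sum_nonneg fun x _ => mul_nonneg (hQ.1 x) (Real.rpow_nonneg (hW.1 x y) _)) hρ
  have hs := Finset.sum_le_sum fun y (_ : y ∈ Finset.univ) => h y
  have e1 : ∑ y, powerMean W ρ y ^ ρ * ∑ x, Q x * W x y ^ (1 / (1 + ρ)) = partitionFn W ρ := by
    calc _ = ∑ x, Q x * ∑ y, W x y ^ (1 / (1 + ρ)) * powerMean W ρ y ^ ρ := by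
          simp_rw [Finset.mul_sum]
          rw [Finset.sum_comm]
          exact Finset.sum_congr rfl fun x _ => Finset.sum_congr rfl fun y _ => by ring
      _ = _ := by
          simp_rw [sum_rpow_mul_eq_partitionFn hW hsym hρ, ← Finset.sum_mul, hQ.2, one_mul]
  have e2 : ∑ y, powerMean W ρ y ^ ρ * powerMean W ρ y = partitionFn W ρ :=
    Finset.sum_congr rfl fun y _ => by
      rw [rpow_one_add_eq_mul (powerMean_nonneg hW ρ y) hρ, mul_comm]
  simp_rw [mul_sub] at hs
  rw [Finset.sum_add_distrib, Finset.sum_sub_distrib, ← Finset.mul_sum, ← Finset.mul_sum, e1, e2,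
    sub_self, add_zero] at hs
  rw [Eo_unif]
  exact neg_le_neg (Real.log_le_log (partitionFn_pos hW ρ) hs)

lemma capacity_le_mutualInfo_unif (hW : IsDMC W) (hsym : GallagerSymmetric W) :
    capacity W ≤ mutualInfo W (unif X) := by
  refine csSup_le ⟨_, unif X, isProbDist_unif, rfl⟩ ?_
  rintro _ ⟨Q, hQ, rfl⟩
  obtain ⟨cls, hrow, hcol⟩ := hsym
  have hU := isProbDist_unif (X := X)
  have hg : ∀ y y', cls y = cls y' → outDist (unif X) W y = outDist (unif X) W y' :=
    fun y y' h => sum_col_eq (hcol y y' h) fun w => (Fintype.card X : ℝ)⁻¹ * w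
  have x₀ := Classical.arbitrary X
  have hx : ∀ x, ∑ y, W x y * Real.log (W x y / outDist (unif X) W y)
      = ∑ y, W x₀ y * Real.log (W x₀ y / outDist (unif X) W y) := fun x =>
    GallagerSymmetric.sum_eq hrow (fun w b => w * Real.log (w / b)) hg x x₀
  have hconst : ∀ P : X → ℝ, IsProbDist P →
      ∑ x, ∑ y, P x * (W x y * Real.log (W x y / outDist (unif X) W y))
        = ∑ y, W x₀ y * Real.log (W x₀ y / outDist (unif X) W y) := fun P hP => by
    simp_rw [← Finset.mul_sum, hx, ← Finset.sum_mul, hP.2, one_mul]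
  calc mutualInfo W Q
      ≤ ∑ x, ∑ y, Q x * (W x y * Real.log (W x y / outDist (unif X) W y)) :=
        mutualInfo_le_divergence hQ hW (outDist_nonneg hU.1 hW) (sum_outDist hU hW)
          fun x y _ h => outDist_pos hU.1 hW (mul_pos (unif_pos x) h)
    _ = ∑ x, ∑ y, unif X x * (W x y * Real.log (W x y / outDist (unif X) W y)) := by
        rw [hconst Q hQ, hconst _ hU]
    _ = _ := by
        simp_rw [← mul_assoc]; rfl

lemma continuousOn_powerMean {A B : Type} [Fintype A] (W : A → B → ℝ) (y : B) :
    ContinuousOn (fun ρ => powerMean W ρ y) (Ici 0) := by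
  refine continuousOn_finsetSum _ fun x _ => continuousOn_const.mul ?_
  refine continuousOn_const.rpow ?_ fun ρ hρ => Or.inr ?_
  · refine continuousOn_const.div (by fun_prop) fun ρ hρ => ?_
    have : (0 : ℝ) ≤ ρ := hρ
    positivity
  · have : (0 : ℝ) ≤ ρ := hρ
    positivity

lemma continuousOn_powerMean_rpow {A B : Type} [Fintype A] (W : A → B → ℝ) (y : B) :
    ContinuousOn (fun ρ => powerMean W ρ y ^ (1 + ρ)) (Ici 0) := by
  refine (continuousOn_powerMean W y).rpow (by fun_prop) fun ρ hρ => Or.inr ?_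
  have : (0 : ℝ) ≤ ρ := hρ
  positivity

lemma continuousOn_partitionFn {A B : Type} [Fintype A] [Fintype B] (W : A → B → ℝ) :
    ContinuousOn (fun ρ => partitionFn W ρ) (Ici 0) :=
  continuousOn_finsetSum _ fun y _ => continuousOn_powerMean_rpow W y

lemma continuousOn_Eo_unif (hW : IsDMC W) :
    ContinuousOn (fun ρ => Eo W (unif X) ρ) (Ici 0) :=
  ((continuousOn_partitionFn W).log fun ρ _ => (partitionFn_pos hW ρ).ne').neg

lemma continuousOn_mutualInfo_tilt (hW : IsDMC W) :
    ContinuousOn (fun ρ => mutualInfo (tilt W ρ) (unif X)) (Ici 0) := by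
  have h : ContinuousOn (fun ρ => ∑ x, ∑ y,
      unif X x * (tilt W ρ x y * Real.log (tilt W ρ x y / qR W ρ y))) (Ici 0) := by
    refine continuousOn_finsetSum _ fun x _ => continuousOn_finsetSum _ fun y _ =>
      continuousOn_const.mul ?_
    rcases (hW.1 x y).eq_or_lt with h | h
    · refine (continuousOn_const (c := (0 : ℝ))).congr fun ρ hρ => ?_
      simp [tilt_eq_zero hρ h.symm]
    · have ht : ContinuousOn (fun ρ => tilt W ρ x y) (Ici 0) := by
        refine ContinuousOn.div (ContinuousOn.mul ?_ ?_) (continuousOn_partitionFn W)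
          fun ρ _ => (partitionFn_pos hW ρ).ne'
        · refine continuousOn_const.rpow ?_ fun ρ _ => Or.inl h.ne'
          refine continuousOn_const.div (by fun_prop) fun ρ hρ => ?_
          have : (0 : ℝ) ≤ ρ := hρ
          positivity
        · exact (continuousOn_powerMean W y).rpow continuousOn_id
            fun ρ _ => Or.inl (powerMean_pos hW ρ h).ne'
      have hq : ContinuousOn (fun ρ => qR W ρ y) (Ici 0) :=
        (continuousOn_powerMean_rpow W y).div (continuousOn_partitionFn W)
          fun ρ _ => (partitionFn_pos hW ρ).ne'
      exact ht.mul ((ht.div hq fun ρ _ => (qR_pos hW ρ h).ne').log fun ρ _ =>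
        (div_pos (tilt_pos hW ρ h) (qR_pos hW ρ h)).ne')
  exact h.congr fun ρ hρ => mutualInfo_tilt hW hρ

lemma bddAbove_ESPset (hW : IsDMC W) (hsym : GallagerSymmetric W) {r : ℝ} (hr : Rinf W < r) :
    BddAbove (ESPset W r) := by
  by_contra h
  refine hr.not_ge (le_csSup ⟨mutualInfo W (unif X), fun r' hr' => ?_⟩ h)
  by_contra! hlt
  refine hr' ⟨0, ?_⟩
  rintro _ ⟨Q, hQ, ρ, hρ, rfl⟩
  have h1 := Eo_le_Eo_unif hW hsym hρ hQ
  have h2 := Eo_unif_le hW hρ hW fun _ _ h => h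
  have h3 : ∑ x, ∑ y, unif X x * (W x y * Real.log (W x y / W x y)) = 0 :=
    Finset.sum_eq_zero fun x _ => Finset.sum_eq_zero fun y _ => by
      by_cases h0 : W x y = 0 <;> simp [h0]
  have := mul_le_mul_of_nonneg_left hlt.le hρ
  linarith

/-- Below capacity and above `R_∞`, the dual problem has a maximiser whose tilted channel has
mutual information equal to the rate. -/
lemma exists_dual_maximizer (hW : IsDMC W) (hsym : GallagerSymmetric W) {r : ℝ}
    (hr1 : Rinf W < r) (hr2 : r < capacity W) :
    ∃ t, 0 ≤ t ∧ (∀ u, 0 ≤ u → Eo W (unif X) u - u * r ≤ Eo W (unif X) t - t * r) ∧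
      mutualInfo (tilt W t) (unif X) = r := by
  obtain ⟨r', hr', hr'r⟩ := exists_between hr1
  obtain ⟨M, hM⟩ := bddAbove_ESPset hW hsym hr'
  have hM' : ∀ u, 0 ≤ u → Eo W (unif X) u - u * r' ≤ M := fun u hu =>
    hM ⟨unif X, isProbDist_unif, u, hu, rfl⟩
  have hM0 : 0 ≤ M := by simpa [Eo_unif_zero hW] using hM' 0 le_rfl
  have hK : 0 ≤ M / (r - r') := div_nonneg hM0 (sub_pos.2 hr'r).le
  obtain ⟨t, ht, hmax⟩ := isCompact_Icc.exists_isMaxOn (nonempty_Icc.2 hK)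
    (f := fun u => Eo W (unif X) u - u * r)
    (((continuousOn_Eo_unif hW).mono fun u hu => hu.1).sub (by fun_prop))
  have hmax' : ∀ u, 0 ≤ u → Eo W (unif X) u - u * r ≤ Eo W (unif X) t - t * r := by
    intro u hu
    by_cases huK : u ≤ M / (r - r')
    · exact hmax ⟨hu, huK⟩
    · have h0 : Eo W (unif X) 0 - 0 * r ≤ Eo W (unif X) t - t * r := hmax ⟨le_rfl, hK⟩
      rw [Eo_unif_zero hW] at h0
      rw [not_le, div_lt_iff₀ (sub_pos.2 hr'r)] at huK
      have := hM' u hu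
      linarith
  refine ⟨t, ht.1, hmax', ?_⟩
  obtain ⟨h1, h2⟩ := (continuousOn_mutualInfo_tilt hW).level_of_crossing (r := r) ht.1 <| by
    intro u hu
    have e1 := divergence_tilt hW hsym hu
    have e2 := Eo_unif_le hW ht.1 (isDMC_tilt hW hsym hu) fun x y => pos_of_tilt_pos hW hu
    rw [e1] at e2
    have := hmax' u hu
    linarith
  rcases ht.1.eq_or_lt with h0 | h0
  · subst h0
    rw [tilt_zero hW] at h1
    exact absurd (hr2.trans_le (capacity_le_mutualInfo_unif hW hsym)) h1.not_gt
  · exact le_antisymm h1 (h2 h0)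

lemma condKL_tilt (hW : IsDMC W) (hsym : GallagerSymmetric W) (hρ : 0 ≤ ρ) :
    condKL (unif X) (tilt W ρ) W
      = ENNReal.ofReal (Eo W (unif X) ρ - ρ * mutualInfo (tilt W ρ) (unif X)) := by
  rw [condKL, if_pos fun x y _ h => pos_of_tilt_pos hW hρ h, divergence_tilt hW hsym hρ]

lemma ofReal_le_ESPQ (hW : IsDMC W) (hρ : 0 ≤ ρ) (r : ℝ) :
    ENNReal.ofReal (Eo W (unif X) ρ - ρ * r) ≤ ESPQ W r (unif X) := by
  refine le_iInf₂ fun V hV => ?_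
  rw [condKL]
  split_ifs with h
  · have h1 := Eo_unif_le hW hρ hV.1 fun x y => h x y (unif_pos x)
    have h2 := mul_le_mul_of_nonneg_left hV.2 hρ
    exact ENNReal.ofReal_le_ofReal (by linarith)
  · exact le_top

end Tilting

/-- **Lemma (regularity-nonsingular)(ii)**: for a symmetric channel with `R_cr < C(W)` and
`R_∞ < R < C(W)`, one has `e_SP(R, R) = E_SP(R)`. -/
theorem statement13 {X Y : Type} [Fintype X] [Fintype Y] [Nonempty X] [Nonempty Y]
    (W : X → Y → ℝ) (hW : IsDMC W) (hsym : GallagerSymmetric W)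
    (hcr : Rcr W < capacity W)
    (R : ℝ) (hR1 : Rinf W < R) (hR2 : R < capacity W)
    (ρR : ℝ) (hρR : HasDerivAt (fun r => (ESPQ W r (unif X)).toReal) (-ρR) R) :
    eSP W (qR W ρR) R = ENNReal.ofReal (ESP W R) := by
  obtain ⟨t, ht, hmax, hI⟩ := exists_dual_maximizer hW hsym hR1 hR2
  have hESPQ : ∀ r u, 0 ≤ u → mutualInfo (tilt W u) (unif X) = r →
      ESPQ W r (unif X) = ENNReal.ofReal (Eo W (unif X) u - u * r) := by
    intro r u hu hr
    refine le_antisymm ?_ (ofReal_le_ESPQ hW hu r)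
    refine (iInf₂_le (tilt W u) ⟨isDMC_tilt hW hsym hu, hr.le⟩).trans ?_
    rw [condKL_tilt hW hsym hu, hr]
  have hESP : ESP W R = Eo W (unif X) t - t * R := by
    refine IsGreatest.csSup_eq ⟨⟨unif X, isProbDist_unif, t, ht, rfl⟩, ?_⟩
    rintro _ ⟨Q, hQ, u, hu, rfl⟩
    linarith [Eo_le_Eo_unif hW hsym hu hQ, hmax u hu]
  have hval : 0 ≤ Eo W (unif X) t - t * R := by
    simpa [Eo_unif_zero hW] using hmax 0 le_rfl
  have ht_eq : t = ρR := by
    have hmin : IsLocalMin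
        (fun r => (ESPQ W r (unif X)).toReal - (Eo W (unif X) t - t * r)) R := by
      filter_upwards [Ioo_mem_nhds hR1 hR2] with r hr
      obtain ⟨u, hu, -, hu'⟩ := exists_dual_maximizer hW hsym hr.1 hr.2
      have hfin : ESPQ W r (unif X) ≠ ⊤ := by
        rw [hESPQ r u hu hu']
        exact ENNReal.ofReal_ne_top
      have hle := (ENNReal.ofReal_le_iff_le_toReal hfin).1 (ofReal_le_ESPQ hW ht r)
      rw [hESPQ R t ht hI, ENNReal.toReal_ofReal hval]
      linarith
    have hd := hmin.hasDerivAt_eq_zero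
      (hρR.sub (((hasDerivAt_id R).const_mul t).const_sub (Eo W (unif X) t)))
    linarith
  subst ht_eq
  rw [hESP, ← hESPQ R t ht hI]
  have hR0 : 0 ≤ R := hI ▸ mutualInfo_nonneg isProbDist_unif (isDMC_tilt hW hsym ht)
  refine le_antisymm ?_ (le_iInf₂ fun V hV => ?_)
  · rw [hESPQ R t ht hI]
    have hac : ∀ x y, 0 < unif X x → 0 < tilt W t x y → 0 < qR W t y :=
      fun x y _ h => qR_pos hW t (pos_of_tilt_pos hW ht h)
    have hout : condKLout (unif X) (tilt W t) (qR W t) ≤ ENNReal.ofReal R := by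
      rw [condKLout, if_pos hac, ← mutualInfo_tilt hW ht, hI]
    refine (iInf₂_le (tilt W t) ⟨isDMC_tilt hW hsym ht, hout⟩).trans_eq ?_
    rw [condKL_tilt hW hsym ht, hI]
  · refine iInf₂_le V ⟨hV.1, ?_⟩
    have h := hV.2
    rw [condKLout] at h
    split_ifs at h with hac
    · exact (mutualInfo_le_divergence isProbDist_unif hV.1 (qR_nonneg hW t) (sum_qR hW t) hac).trans
        ((ENNReal.ofReal_le_ofReal_iff hR0).1 h)
    · exact absurd h (by simp)
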